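/- (Arratia–Goldstein–Gordon / Chen–Stein) Let X_1,…,X_N be Bernoulli random variables with p_i = E[X_i] > 0, let S_N = Σ_{i=1}^N X_i and λ = Σ_{i=1}^N p_i, and let G be a dependency graph of {X_i}. Let Z be a Poisson random variable with mean λ. Then for every subset A ⊆ ℕ, | P(S_N ∈ A) − P(Z ∈ A) | ≤ B_1(G) + B_2(G). -/

import Mathlib

open MeasureTheory ProbabilityTheory Filter

noncomputable section

/-- A (reflexive, symmetric) relation `R` on `{1,…,N}` is a dependency graph for the
family `{X_i}` if each `X_i` is independent of the family `{X_j : ¬ R i j}`. -/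
def IsDependencyGraph {Ω : Type*} [MeasurableSpace Ω] (μ : Measure Ω)
    {N : ℕ} (X : Fin N → Ω → ℕ) (R : Fin N → Fin N → Prop) : Prop :=
  (∀ i, R i i) ∧ (∀ i j, R i j → R j i) ∧
    ∀ i, IndepFun (X i) (fun ω => fun j : {j // ¬ R i j} => X j.1 ω) μ

open scoped Classical in
/-- `B₁ = Σ_i Σ_{j ~ i} E[X_i]·E[X_j]`. -/
def B1 {Ω : Type*} [MeasurableSpace Ω] (μ : Measure Ω)
    {N : ℕ} (X : Fin N → Ω → ℕ) (R : Fin N → Fin N → Prop) : ℝ :=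
  ∑ i, ∑ j ∈ Finset.univ.filter (fun j => R i j),
    (∫ ω, (X i ω : ℝ) ∂μ) * (∫ ω, (X j ω : ℝ) ∂μ)

open scoped Classical in
/-- `B₂ = Σ_i Σ_{j ≠ i, j ~ i} E[X_i·X_j]`. -/
def B2 {Ω : Type*} [MeasurableSpace Ω] (μ : Measure Ω)
    {N : ℕ} (X : Fin N → Ω → ℕ) (R : Fin N → Fin N → Prop) : ℝ :=
  ∑ i, ∑ j ∈ Finset.univ.filter (fun j => j ≠ i ∧ R i j),
    ∫ ω, (X i ω : ℝ) * (X j ω : ℝ) ∂μ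

/-- Tail comparison for a weight with `(n + 1) w (n + 1) = r w n`. -/
lemma nat_mul_tail_le_of_poisson_recursion {r : ℝ} {w : ℕ → ℝ} (hw : ∀ n, 0 < w n)
    (hrec : ∀ n : ℕ, ((n : ℝ) + 1) * w (n + 1) = r * w n) (hsum : HasSum w 1) (k m : ℕ)
    (hm : m ≤ k + 1) :
    (m : ℝ) * (1 - ∑ j ∈ Finset.range (k + 1), w j) ≤ r * (1 - ∑ j ∈ Finset.range k, w j) := by
  have h1 := ((hasSum_nat_add_iff' (k + 1)).2 hsum).mul_left (m : ℝ)
  have h2 := ((hasSum_nat_add_iff' k).2 hsum).mul_left r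
  refine hasSum_le (fun n => ?_) h1 h2
  rw [← hrec (n + k), ← add_assoc]
  refine mul_le_mul_of_nonneg_right ?_ (hw _).le
  have : m ≤ n + k + 1 := by omega
  exact_mod_cast this

/-- The one-step increment bound for the Stein solution, in terms of the mass `F` below a point,
the mass `p` of the point, and the masses `a`, `c` of the set below and above the point. -/
lemma abs_stein_increment_le_one {r k F p w₀ a c e : ℝ} (hr : 0 < r) (hk : 0 < k) (hp : 0 < p)
    (hw₀ : 1 - w₀ ≤ r) (hF : 0 ≤ F) (hT : 0 ≤ 1 - F - p) (ha : 0 ≤ a) (haF : a ≤ F)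
    (hc : 0 ≤ c) (hcT : c ≤ 1 - F - p) (he : 0 ≤ e) (he1 : e ≤ 1) (hw₀_nonneg : 0 ≤ w₀)
    (hup : k * (1 - F - p) ≤ r * (1 - F)) (hlow : r * F ≤ k * (F + p - w₀)) :
    |((a + e * p) - (a + e * p + c) * (F + p)) / (r * p) - (a - (a + e * p + c) * F) / (k * p)|
      ≤ 1 := by
  set x := (1 - F - p) / r - (1 - F) / k with hx
  set y := (1 - F - p) / r + F / k with hy
  set z := F / k - (F + p) / r with hz
  have hx0 : x ≤ 0 := by
    rw [hx, sub_nonpos, div_le_div_iff₀ hr hk]; linarith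
  have hFk : F / k ≤ (F + p - w₀) / r := by
    rw [div_le_div_iff₀ hk hr]; linarith
  have hz0 : z ≤ 0 := by
    have : (F + p - w₀) / r ≤ (F + p) / r := by gcongr; linarith
    linarith
  have hy0 : 0 ≤ y := by positivity
  have hy1 : y ≤ 1 := by
    have h : (1 - F - p) / r + (F + p - w₀) / r ≤ 1 := by
      rw [← add_div, div_le_one hr]; linarith
    linarith
  have hD : ((a + e * p) - (a + e * p + c) * (F + p)) / (r * p)
      - (a - (a + e * p + c) * F) / (k * p) = (a * x + e * p * y + c * z) / p := by
    rw [hx, hy, hz]; field_simp; ring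
  have hFT : F * x + (1 - F - p) * z = -(p * y) := by
    rw [hx, hy, hz]; field_simp; ring
  have hax := mul_le_mul_of_nonpos_right haF hx0
  have hcz := mul_le_mul_of_nonpos_right hcT hz0
  have hax0 := mul_nonpos_of_nonneg_of_nonpos ha hx0
  have hcz0 := mul_nonpos_of_nonneg_of_nonpos hc hz0
  have hpy : p * y ≤ p := mul_le_of_le_one_right hp.le hy1
  have hpy0 : 0 ≤ p * y := by positivity
  have hepy : e * p * y ≤ p * y := by
    rw [mul_assoc]; exact mul_le_of_le_one_left hpy0 he1
  have hepy0 : 0 ≤ e * p * y := by positivity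
  rw [hD, abs_div, abs_of_pos hp, div_le_one hp, abs_le]
  constructor <;> linarith

/-- Solution of the Poisson Stein equation for the indicator of a set, with increments
bounded by one. -/
lemma exists_stein_solution {r : ℝ} (hr : 0 < r) {w : ℕ → ℝ} (hw : ∀ n, 0 < w n)
    (hrec : ∀ n : ℕ, ((n : ℝ) + 1) * w (n + 1) = r * w n) (hsum : HasSum w 1) (A : Set ℕ) :
    ∃ f : ℕ → ℝ,
      (∀ n : ℕ, r * f (n + 1) - n * f n = A.indicator 1 n - ∑' k, A.indicator w k) ∧
      ∀ n, |f (n + 2) - f (n + 1)| ≤ 1 := by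
  classical
  set F : ℕ → ℝ := fun n => ∑ j ∈ Finset.range n, w j with hF
  set a : ℕ → ℝ := fun n => ∑ j ∈ Finset.range n, A.indicator w j with ha
  set P := ∑' k, A.indicator w k with hP
  have hind0 : ∀ n, 0 ≤ A.indicator w n := fun n => Set.indicator_nonneg (fun _ _ => (hw _).le) n
  have hindle : ∀ n, A.indicator w n ≤ w n :=
    fun n => Set.indicator_le_self' (fun _ _ => (hw _).le) n
  have hPsum : HasSum (A.indicator w) P := (hsum.summable.indicator A).hasSum
  have hFs : ∀ n, F (n + 1) = F n + w n := fun n => Finset.sum_range_succ _ _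
  have has : ∀ n, a (n + 1) = a n + A.indicator 1 n * w n := by
    intro n
    simp only [ha, Finset.sum_range_succ]
    by_cases h : n ∈ A <;> simp [h]
  refine ⟨fun n => (a n - P * F n) / (n * w n), fun n => ?_, fun n => ?_⟩
  · have hwn := (hw n).ne'
    have h1 : r * ((a (n + 1) - P * F (n + 1)) / (((n + 1 : ℕ) : ℝ) * w (n + 1)))
        = (a (n + 1) - P * F (n + 1)) / w n := by
      push_cast; rw [hrec]; field_simp
    have h2 : (n : ℝ) * ((a n - P * F n) / (n * w n)) = (a n - P * F n) / w n := by
      rcases Nat.eq_zero_or_pos n with rfl | hn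
      · simp [ha, hF]
      · have : (n : ℝ) ≠ 0 := by positivity
        field_simp
    rw [h1, h2, has, hFs]
    field_simp
    ring
  · have hrec' : ((n + 2 : ℕ) : ℝ) * w (n + 2) = r * w (n + 1) := by
      rw [← hrec (n + 1)]; push_cast; ring
    have hPeq : P = a (n + 1) + A.indicator 1 (n + 1) * w (n + 1) + (P - a (n + 2)) := by
      rw [has (n + 1)]; ring
    have hw0 := nat_mul_tail_le_of_poisson_recursion hw hrec hsum 0 1 le_rfl
    have htail := nat_mul_tail_le_of_poisson_recursion hw hrec hsum (n + 1) (n + 1) (by omega)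
    have hT : 1 - F (n + 1) - w (n + 1) = 1 - F (n + 2) := by rw [hFs (n + 1)]; ring
    have hlow : r * F (n + 1) ≤ ((n + 1 : ℕ) : ℝ) * (F (n + 1) + w (n + 1) - w 0) := by
      have h : F (n + 1) + w (n + 1) - w 0 = ∑ j ∈ Finset.range (n + 1), w (j + 1) := by
        rw [← hFs, hF]; simp only [Finset.sum_range_succ' w (n + 1)]; ring
      rw [h, hF, Finset.mul_sum, Finset.mul_sum]
      refine Finset.sum_le_sum fun j hj => ?_
      rw [← hrec j]
      refine mul_le_mul_of_nonneg_right ?_ (hw _).le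
      have := Finset.mem_range.1 hj
      exact_mod_cast this
    simp only
    rw [hrec', has (n + 1), hFs (n + 1)]
    have key := abs_stein_increment_le_one (r := r) (k := ((n + 1 : ℕ) : ℝ)) (F := F (n + 1))
      (p := w (n + 1)) (w₀ := w 0) (a := a (n + 1)) (c := P - a (n + 2))
      (e := A.indicator 1 (n + 1)) hr (by positivity) (hw _) (by simpa using hw0)
      (Finset.sum_nonneg fun _ _ => (hw _).le)
      (by rw [hT]; exact sub_nonneg.2 (sum_le_hasSum _ (fun _ _ => (hw _).le) hsum))
      (Finset.sum_nonneg fun _ _ => hind0 _) (Finset.sum_le_sum fun _ _ => hindle _)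
      (sub_nonneg.2 (sum_le_hasSum _ (fun _ _ => hind0 _) hPsum))
      (by
        rw [hT]
        exact hasSum_le (fun _ => hindle _) ((hasSum_nat_add_iff' (n + 2)).2 hPsum)
          ((hasSum_nat_add_iff' (n + 2)).2 hsum))
      (Set.indicator_nonneg (fun _ _ => zero_le_one) _)
      (Set.indicator_le_self' (fun _ _ => zero_le_one) _) (hw 0).le
      (by rw [hT]; exact htail) hlow
    rw [← hPeq] at key
    exact key

lemma abs_sub_le_of_increments_le_one {f : ℕ → ℝ} (hf : ∀ n, |f (n + 2) - f (n + 1)| ≤ 1)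
    (b d : ℕ) : |f (b + d + 1) - f (b + 1)| ≤ d := by
  induction d with
  | zero => simp
  | succ d ih =>
    calc |f (b + (d + 1) + 1) - f (b + 1)|
        ≤ |f (b + d + 2) - f (b + d + 1)| + |f (b + d + 1) - f (b + 1)| := abs_sub_le _ _ _
      _ ≤ 1 + d := add_le_add (hf _) ih
      _ = ((d + 1 : ℕ) : ℝ) := by push_cast; ring

/-- Any real function of finitely many `{0,1}`-valued variables is integrable. -/
lemma integrable_comp_of_zero_or_one {Ω : Type*} [MeasurableSpace Ω] (μ : Measure Ω)
    [IsFiniteMeasure μ] {N : ℕ} {X : Fin N → Ω → ℕ} (hmeas : ∀ i, Measurable (X i))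
    (hber : ∀ i ω, X i ω = 0 ∨ X i ω = 1) (Φ : (Fin N → ℕ) → ℝ) :
    Integrable (fun ω => Φ (fun i => X i ω)) μ := by
  refine Integrable.of_bound
    ((measurable_of_countable Φ).comp (measurable_pi_lambda _ hmeas)).aestronglyMeasurable
    (∑ x ∈ Fintype.piFinset fun _ : Fin N => Finset.range 2, ‖Φ x‖) (ae_of_all _ fun ω => ?_)
  refine Finset.single_le_sum (f := fun x => ‖Φ x‖) (fun _ _ => norm_nonneg _)
    (Fintype.mem_piFinset.2 fun i => ?_)
  rcases hber i ω with h | h <;> simp [h]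

open scoped Classical in
/-- Bound on the contribution of a single index to the Stein expectation. -/
lemma abs_integral_stein_term_le {Ω : Type*} [MeasurableSpace Ω] (μ : Measure Ω)
    [IsProbabilityMeasure μ] {N : ℕ} {X : Fin N → Ω → ℕ} (hmeas : ∀ i, Measurable (X i))
    (hber : ∀ i ω, X i ω = 0 ∨ X i ω = 1) {R : Fin N → Fin N → Prop}
    (hdep : IsDependencyGraph μ X R) {f : ℕ → ℝ} (hf : ∀ n, |f (n + 2) - f (n + 1)| ≤ 1)
    (i : Fin N) :
    |∫ ω, ((∫ ω, (X i ω : ℝ) ∂μ) * f (∑ j, X j ω + 1) - X i ω * f (∑ j, X j ω)) ∂μ| ≤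
      ∑ j ∈ Finset.univ.filter (fun j => R i j),
          (∫ ω, (X i ω : ℝ) ∂μ) * (∫ ω, (X j ω : ℝ) ∂μ) +
        ∑ j ∈ Finset.univ.filter (fun j => j ≠ i ∧ R i j), ∫ ω, (X i ω : ℝ) * (X j ω : ℝ) ∂μ := by
  have hX_int := integrable_comp_of_zero_or_one μ hmeas hber
  obtain ⟨hrefl, -, hind⟩ := hdep
  set p := ∫ ω, (X i ω : ℝ) ∂μ with hp
  have hp0 : 0 ≤ p := integral_nonneg fun ω => Nat.cast_nonneg _
  let V : (Fin N → ℕ) → ℕ := fun x => ∑ j ∈ Finset.univ.filter (fun j => ¬ R i j), x j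
  let U : (Fin N → ℕ) → ℕ := fun x => ∑ j ∈ Finset.univ.filter (fun j => R i j), x j
  let W : (Fin N → ℕ) → ℕ := fun x => ∑ j ∈ Finset.univ.filter (fun j => j ≠ i ∧ R i j), x j
  have hS : ∀ x : Fin N → ℕ, ∑ j, x j = V x + U x := fun x => by
    rw [add_comm]; exact (Finset.sum_filter_add_sum_filter_not _ _ _).symm
  have hU : ∀ x, U x = W x + x i := fun x => by
    have h : Finset.univ.filter (fun j => j ≠ i ∧ R i j) =
        (Finset.univ.filter (fun j => R i j)).erase i := by
      ext j; simp
    simp only [U, W, h]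
    exact (Finset.sum_erase_add _ _ (by simp [hrefl i])).symm
  have hindep : ∫ ω, (X i ω : ℝ) * f (V (fun j => X j ω) + 1) ∂μ
      = p * ∫ ω, f (V (fun j => X j ω) + 1) ∂μ := by
    have h := (hind i).integral_fun_comp_mul_comp (f := fun n : ℕ => (n : ℝ))
      (g := fun y : {j // ¬ R i j} → ℕ => f (∑ j, y j + 1)) (hmeas i).aemeasurable
      (measurable_pi_lambda _ fun j : {j // ¬ R i j} => hmeas j.1).aemeasurable
      (measurable_of_countable _).aestronglyMeasurable
      (measurable_of_countable _).aestronglyMeasurable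
    have hV : ∀ ω, ∑ j : {j // ¬ R i j}, X j.1 ω = V (fun j => X j ω) := fun ω =>
      (Finset.sum_subtype (Finset.univ.filter (fun j => ¬ R i j)) (by simp)
        (fun j => X j ω)).symm
    simpa only [hV] using h
  have hIV : Integrable (fun ω => p * f (V (fun j => X j ω) + 1)
      - X i ω * f (V (fun j => X j ω) + 1)) μ :=
    hX_int fun x => p * f (V x + 1) - x i * f (V x + 1)
  have hzero : ∫ ω, (p * f (V (fun j => X j ω) + 1) - X i ω * f (V (fun j => X j ω) + 1)) ∂μ
      = 0 := by
    rw [integral_sub (hX_int fun x => p * f (V x + 1)) (hX_int fun x => x i * f (V x + 1)),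
      hindep, integral_const_mul, sub_self]
  have hIS : Integrable (fun ω => p * f (∑ j, X j ω + 1) - X i ω * f (∑ j, X j ω)) μ :=
    hX_int fun x => p * f (∑ j, x j + 1) - x i * f (∑ j, x j)
  have hIB : Integrable (fun ω => p * (U (fun j => X j ω) : ℝ)
      + X i ω * (W (fun j => X j ω) : ℝ)) μ :=
    hX_int fun x => p * (U x : ℝ) + x i * (W x : ℝ)
  have hEU : ∫ ω, p * (U (fun j => X j ω) : ℝ) ∂μ =
      ∑ j ∈ Finset.univ.filter (fun j => R i j), p * (∫ ω, (X j ω : ℝ) ∂μ) := by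
    simp only [U, Nat.cast_sum]
    rw [integral_const_mul, integral_finsetSum _ fun j _ => hX_int fun x => (x j : ℝ),
      Finset.mul_sum]
  have hEW : ∫ ω, X i ω * (W (fun j => X j ω) : ℝ) ∂μ =
      ∑ j ∈ Finset.univ.filter (fun j => j ≠ i ∧ R i j), ∫ ω, (X i ω : ℝ) * (X j ω : ℝ) ∂μ := by
    simp only [W, Nat.cast_sum, Finset.mul_sum]
    rw [integral_finsetSum _ fun j _ => hX_int fun x => (x i : ℝ) * x j]
  rw [← sub_zero (∫ ω, _ ∂μ), ← hzero, ← integral_sub hIS hIV, ← hEU, ← hEW,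
    ← integral_add (hX_int fun x => p * (U x : ℝ)) (hX_int fun x => x i * (W x : ℝ))]
  refine (abs_integral_le_integral_abs).trans (integral_mono (hIS.sub hIV).abs hIB fun ω => ?_)
  have hSω := hS fun j => X j ω
  have hUω := hU fun j => X j ω
  have h1 := abs_sub_le_of_increments_le_one hf (V fun j => X j ω) (U fun j => X j ω)
  have h2 := abs_sub_le_of_increments_le_one hf (V fun j => X j ω) (W fun j => X j ω)
  have h3 := mul_le_mul_of_nonneg_left h1 hp0
  rw [← abs_of_nonneg hp0, ← abs_mul, abs_of_nonneg hp0] at h3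
  simp only
  rw [hSω]
  rcases hber i ω with h | h
  · simp only [h, Nat.cast_zero, zero_mul, sub_zero, add_zero]
    rwa [← mul_sub]
  · simp only [h] at hUω
    rw [hUω] at h3 ⊢
    simp only [h, Nat.cast_one, one_mul]
    simp only [← add_assoc] at h3 ⊢
    rw [abs_le] at h2 h3 ⊢
    constructor <;> linarith

lemma integral_indicator_sum_eq {Ω : Type*} [MeasurableSpace Ω] (μ : Measure Ω)
    {S : Ω → ℕ} (hS : Measurable S) (A : Set ℕ) :
    ∫ ω, A.indicator (1 : ℕ → ℝ) (S ω) ∂μ = (μ {ω | S ω ∈ A}).toReal := by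
  have hA : MeasurableSet (S ⁻¹' A) := hS (.of_discrete)
  have h := integral_indicator_one (μ := μ) hA
  exact h

theorem chen_stein_arratia_goldstein_gordon
    {Ω : Type*} [MeasurableSpace Ω] (μ : Measure Ω) [IsProbabilityMeasure μ]
    (N : ℕ) (X : Fin N → Ω → ℕ)
    (hmeas : ∀ i, Measurable (X i))
    (hber : ∀ i ω, X i ω = 0 ∨ X i ω = 1)
    (hpos : ∀ i, 0 < ∫ ω, (X i ω : ℝ) ∂μ)
    (R : Fin N → Fin N → Prop)
    (hdep : IsDependencyGraph μ X R)
    (A : Set ℕ) :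
    |(μ {ω | (∑ i, X i ω) ∈ A}).toReal -
        ∑' k : A, Real.exp (-(∑ i, ∫ ω, (X i ω : ℝ) ∂μ)) *
          (∑ i, ∫ ω, (X i ω : ℝ) ∂μ) ^ (k : ℕ) / Nat.factorial (k : ℕ)| ≤
      B1 μ X R + B2 μ X R := by
  have hX_int := integrable_comp_of_zero_or_one μ hmeas hber
  have hSmeas : Measurable fun ω => ∑ i, X i ω :=
    Finset.measurable_sum _ fun i _ => hmeas i
  rcases Nat.eq_zero_or_pos N with rfl | hN
  · have h0 : ∑' k : A, Real.exp (-0) * (0 : ℝ) ^ (k : ℕ) / Nat.factorial (k : ℕ)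
        = A.indicator (1 : ℕ → ℝ) 0 := by
      rw [tsum_subtype A fun k => Real.exp (-0) * (0 : ℝ) ^ k / Nat.factorial k,
        tsum_eq_single 0 fun k hk => by simp [Set.indicator, hk]]
      simp [Set.indicator]
    rw [← integral_indicator_sum_eq μ hSmeas]
    simp only [Finset.univ_eq_empty, Finset.sum_empty, h0]
    simp [B1, B2]
  set r := ∑ i, ∫ ω, (X i ω : ℝ) ∂μ with hr_def
  have hr : 0 < r := Finset.sum_pos (fun i _ => hpos i) ⟨⟨0, hN⟩, Finset.mem_univ _⟩
  set w : ℕ → ℝ := fun k => Real.exp (-r) * r ^ k / Nat.factorial k with hw_def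
  have hw : ∀ n, 0 < w n := fun n => by positivity
  have hrec : ∀ n : ℕ, ((n : ℝ) + 1) * w (n + 1) = r * w n := fun n => by
    simp only [hw_def, Nat.factorial_succ]
    push_cast
    field_simp
    ring
  have hsum : HasSum w 1 := hasSum_one_poissonMeasure ⟨r, hr.le⟩
  obtain ⟨f, hstein, hf⟩ := exists_stein_solution hr hw hrec hsum A
  have hP : ∑' k : A, Real.exp (-r) * r ^ (k : ℕ) / Nat.factorial (k : ℕ)
      = ∑' k, A.indicator w k := tsum_subtype A w
  have hlhs : (μ {ω | (∑ i, X i ω) ∈ A}).toReal - ∑' k, A.indicator w k =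
      ∑ i, ∫ ω, ((∫ ω, (X i ω : ℝ) ∂μ) * f (∑ j, X j ω + 1) - X i ω * f (∑ j, X j ω)) ∂μ := by
    rw [← integral_indicator_sum_eq μ hSmeas,
      ← integral_finsetSum _ fun i _ =>
        hX_int fun x => (∫ ω, (X i ω : ℝ) ∂μ) * f (∑ j, x j + 1) - x i * f (∑ j, x j)]
    have hone : ∑' k, A.indicator w k = ∫ _, ∑' k, A.indicator w k ∂μ := by simp
    rw [hone, ← integral_sub (hX_int fun x => A.indicator (1 : ℕ → ℝ) (∑ i, x i))
      (integrable_const _)]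
    refine integral_congr_ae (ae_of_all _ fun ω => ?_)
    simp only [← hstein]
    rw [Finset.sum_sub_distrib, ← Finset.sum_mul, ← Finset.sum_mul, Nat.cast_sum]
  rw [hP, hlhs, B1, B2, ← Finset.sum_add_distrib]
  exact (Finset.abs_sum_le_sum_abs _ _).trans
    (Finset.sum_le_sum fun i _ => abs_integral_stein_term_le μ hmeas hber hdep hf i)
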